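/- Let I be a nonempty finite index set, and for each i ∈ I let μᵢ and νᵢ be probability measures on a measurable space Xᵢ and εᵢ ≥ 0 a real number. Suppose there is an index j ∈ I such that μᵢ = νᵢ for all i ≠ j, and μⱼ(S) ≤ exp(εⱼ)·νⱼ(S) for every measurable S ⊆ Xⱼ. Then the product measures satisfy (⊗ᵢ μᵢ)(S) ≤ exp(max_{i∈I} εᵢ) · (⊗ᵢ νᵢ)(S) for every measurable set S in the product space ∏ᵢ Xᵢ. -/

import Mathlib

open MeasureTheory

/-- Domination of each factor by a finite multiple passes to the product measure. -/
theorem pi_le_prod_smul_pi {I : Type*} [Fintype I] {X : I → Type*}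
    [∀ i, MeasurableSpace (X i)] {μ ν : ∀ i, Measure (X i)} {c : I → ENNReal}
    (hc : ∀ i, c i ≠ ⊤) (h : ∀ i, μ i ≤ c i • ν i) :
    Measure.pi μ ≤ (∏ i, c i) • Measure.pi ν := by
  refine Measure.le_iff.2 fun S hS ↦ ?_
  rw [Measure.smul_apply, Measure.pi, Measure.pi, toMeasure_apply _ _ hS, toMeasure_apply _ _ hS,
    ← _root_.smul_apply]
  revert S
  suffices OuterMeasure.pi (fun i ↦ (μ i).toOuterMeasure) ≤
      (∏ i, c i) • OuterMeasure.pi (fun i ↦ (ν i).toOuterMeasure) from fun S _ ↦ this S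
  rw [OuterMeasure.pi, OuterMeasure.pi,
    OuterMeasure.smul_boundedBy (ENNReal.prod_ne_top fun i _ ↦ hc i), OuterMeasure.le_boundedBy]
  refine fun S ↦ (OuterMeasure.boundedBy_le S).trans ?_
  simp only [piPremeasure, Pi.smul_apply, smul_eq_mul, ← Finset.prod_mul_distrib]
  exact Finset.prod_le_prod' fun i _ ↦ h i _

/-- Parallel composition for differential privacy: if the measures differ only
at a single index `j`, where the pair `(μ j, ν j)` satisfies the `ε j`-DP
inequality, then the product measures satisfy the `(max_i ε i)`-DP
inequality. -/
theorem parallel_composition_product_dp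
    {I : Type*} [Fintype I] [Nonempty I] {X : I → Type*}
    [∀ i, MeasurableSpace (X i)]
    (ε : I → ℝ) (hε : ∀ i, 0 ≤ ε i)
    (μ ν : ∀ i, Measure (X i))
    [∀ i, IsProbabilityMeasure (μ i)] [∀ i, IsProbabilityMeasure (ν i)]
    (j : I) (hne : ∀ i, i ≠ j → μ i = ν i)
    (hj : ∀ S : Set (X j), MeasurableSet S →
      μ j S ≤ ENNReal.ofReal (Real.exp (ε j)) * ν j S) :
    ∀ S : Set (∀ i, X i), MeasurableSet S →
      Measure.pi μ S ≤
        ENNReal.ofReal (Real.exp (Finset.univ.sup' Finset.univ_nonempty ε)) *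
          Measure.pi ν S := by
  classical
  intro S _
  have hle := pi_le_prod_smul_pi
    (c := Pi.mulSingle j (ENNReal.ofReal (Real.exp (ε j)))) (μ := μ) (ν := ν)
    (fun i ↦ by
      obtain rfl | hi := eq_or_ne i j
      · simp
      · simp [hi])
    (fun i ↦ by
      obtain rfl | hi := eq_or_ne i j
      · simpa using Measure.le_iff.2 hj
      · simp [hi, hne i hi])
  rw [Fintype.prod_pi_mulSingle'] at hle
  refine (hle S).trans ?_
  rw [Measure.smul_apply, smul_eq_mul]
  gcongr
  exact Finset.le_sup' ε (Finset.mem_univ j)
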